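/- arXiv:2302.01900 — 2 statements merged into one kernel-verified Lean document; each statement's English description precedes it below -/
import Mathlib

section
/- Let b ≥ 2 be an integer, let j be an integer with 1 ≤ j ≤ b−1, and let x ≥ 1 be a real number. Set n = ⌈x⌉ and m = ⌊log_b n⌋, and assume ⌊log_b x⌋ = m. Then ∑_{k=0}^{⌊log_b x⌋} ⌈(x + j·b^k) / b^{k+1}⌉ = (n − s_b(n))/(b−1) + m + λ'_{b−j}(n) + [c_{ν_b(n)} ≠ b−j], where c_{ν_b(n)} = ⌊n / b^{ν_b(n)}⌋ mod b is the lowest nonzero b-ary digit of n. -/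
/-- The sum of the `b`-ary digits of `n`. -/
def digitSum (b n : ℕ) : ℕ := (Nat.digits b n).sum

/-- `conjPart b n i` is `λ'_i(n)`: the number of `b`-ary digits of `n` that are `≥ i`. -/
def conjPart (b n i : ℕ) : ℕ := ((Nat.digits b n).filter (fun c => i ≤ c)).length

theorem conjPart_eq_sum (b n i : ℕ) (hb : 2 ≤ b) (hn : n ≠ 0) :
    conjPart b n i =
      ∑ k ∈ Finset.range (Nat.log b n + 1), if i ≤ n / b ^ k % b then 1 else 0 := by
  have filter_length (l : List ℕ) : (l.filter (fun c => i ≤ c)).length =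
      ∑ k ∈ Finset.range l.length, if i ≤ l.getD k 0 then 1 else 0 := by
    induction l with
    | nil => simp
    | cons a l ih =>
      rw [List.length_cons, Finset.sum_range_succ']
      simp only [List.getD_cons_succ, List.getD_cons_zero, ← ih, List.filter_cons]
      by_cases h : i ≤ a <;> simp [h]
  rw [conjPart, filter_length, Nat.length_digits b n (by omega) hn]
  exact Finset.sum_congr rfl fun k _ => by rw [Nat.getD_digits n k hb]

theorem sum_range_div_pow_succ (b n : ℕ) (hb : 2 ≤ b) :
    ∑ k ∈ Finset.range (Nat.log b n + 1), n / b ^ (k + 1) = (n - digitSum b n) / (b - 1) := by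
  rw [digitSum, ← Nat.sub_one_mul_sum_log_div_pow_eq_sub_sum_digits,
    Nat.mul_div_cancel_left _ (by omega)]

/-- The lowest nonzero digit of `n` is the only nonzero digit whose place value divides `n`. -/
theorem sum_range_digit_eq_and_dvd (b n i : ℕ) (hb : 2 ≤ b) (hn : n ≠ 0) (hi : i ≠ 0) :
    (∑ k ∈ Finset.range (Nat.log b n + 1), if n / b ^ k % b = i ∧ b ^ k ∣ n then 1 else 0) =
      if n / b ^ padicValNat b n % b = i then 1 else 0 := by
  have hdvd (k : ℕ) : b ^ k ∣ n ↔ k ≤ padicValNat b n :=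
    padicValNat_dvd_iff_le_of_ne_one (by omega) hn
  rw [Finset.sum_eq_single (padicValNat b n)]
  · simp [(hdvd _).2 le_rfl]
  · intro k _ hk
    refine if_neg fun ⟨hdigit, hpow⟩ => hi ?_
    have hlt : k + 1 ≤ padicValNat b n := lt_of_le_of_ne ((hdvd k).1 hpow) hk
    obtain ⟨q, rfl⟩ := (hdvd _).2 hlt
    rw [← hdigit, pow_succ, mul_assoc, Nat.mul_div_cancel_left _ (by positivity),
      Nat.mul_mod_right]
  · intro h
    refine absurd (Finset.mem_range.2 (Nat.lt_succ_of_le ?_)) h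
    exact Nat.le_log_of_pow_le (by omega) (Nat.le_of_dvd (by omega) ((hdvd _).2 le_rfl))

theorem ceil_add_mul_pow_div (b j k n : ℕ) (hb : 2 ≤ b) (hj1 : 1 ≤ j) (hj2 : j ≤ b - 1)
    (x : ℝ) (hn : (n : ℤ) = ⌈x⌉) :
    ⌈(x + j * (b : ℝ) ^ k) / b ^ (k + 1)⌉ + (if n / b ^ k % b = b - j ∧ b ^ k ∣ n then 1 else 0)
      = n / (b : ℤ) ^ (k + 1) + 1 + if b - j ≤ n / b ^ k % b then 1 else 0 := by
  obtain ⟨hx1, hx2⟩ := Int.ceil_eq_iff.1 hn.symm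
  push_cast at hx1 hx2
  have hB : 0 < b ^ k := by positivity
  have ceil_eq (z : ℕ) (hlow : z * (b ^ k * b) + 1 ≤ n + j * b ^ k)
      (hupp : n + j * b ^ k ≤ (z + 1) * (b ^ k * b)) :
      ⌈(x + j * (b : ℝ) ^ k) / b ^ (k + 1)⌉ = (z : ℤ) + 1 := by
    have hpos : (0 : ℝ) < (b : ℝ) ^ (k + 1) := by positivity
    have hlow' : (z : ℝ) * (b ^ k * b) + 1 ≤ n + j * b ^ k := by exact_mod_cast hlow
    have hupp' : (n : ℝ) + j * b ^ k ≤ (z + 1) * (b ^ k * b) := by exact_mod_cast hupp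
    rw [Int.ceil_eq_iff, lt_div_iff₀ hpos, div_le_iff₀ hpos, pow_succ]
    push_cast
    constructor <;> linarith
  have hdiv : (n : ℤ) / (b : ℤ) ^ (k + 1) = ((n / b ^ k / b : ℕ) : ℤ) := by
    rw [Nat.div_div_eq_div_mul, ← pow_succ]
    push_cast
    rfl
  have hr := Nat.mod_lt n hB
  have hc := Nat.mod_lt (n / b ^ k) (by omega : b > 0)
  have hexp : n = n / b ^ k / b * (b ^ k * b) + n / b ^ k % b * b ^ k + n % b ^ k := by
    conv_lhs => rw [← Nat.div_add_mod n (b ^ k), ← Nat.div_add_mod (n / b ^ k) b]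
    ring
  rw [hdiv]
  simp only [Nat.dvd_iff_mod_eq_zero]
  generalize n / b ^ k / b = d at *
  generalize n / b ^ k % b = c at *
  generalize n % b ^ k = r at *
  generalize b ^ k = B at *
  obtain ⟨i, rfl⟩ : ∃ i, b = i + j := ⟨b - j, by omega⟩
  simp only [Nat.add_sub_cancel] at *
  by_cases hcarry : i < c ∨ (c = i ∧ r ≠ 0)
  · rw [ceil_eq (d + 1) ?_ ?_, if_neg (by omega), if_pos (by omega)]
    · push_cast
      ring
    · rcases hcarry with h | ⟨rfl, h⟩
      · nlinarith [Nat.mul_le_mul_right B h]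
      · nlinarith [Nat.pos_of_ne_zero h]
    · nlinarith [Nat.mul_le_mul_right B hc, Nat.mul_le_mul_right B (by omega : j + 1 ≤ i + j)]
  · have hle : c ≤ i := by omega
    rw [ceil_eq d ?_ ?_]
    · split_ifs <;> omega
    · nlinarith [Nat.mul_le_mul_right B hj1]
    · rcases hle.lt_or_eq with h | rfl
      · nlinarith [Nat.mul_le_mul_right B h]
      · obtain rfl : r = 0 := by omega
        nlinarith

/-- For a base `b ≥ 2`, an integer `1 ≤ j ≤ b-1` and a real `x ≥ 1`, with `n = ⌈x⌉`,
`m = ⌊log_b n⌋`, and assuming `⌊log_b x⌋ = m`, we have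
`∑_{k=0}^{⌊log_b x⌋} ⌈(x + j·b^k)/b^(k+1)⌉
  = (n − s_b(n))/(b−1) + m + λ'_{b−j}(n) + [c_{ν_b(n)} ≠ b−j]`,
where `c_{ν_b(n)} = ⌊n/b^(ν_b(n))⌋ mod b` is the lowest nonzero `b`-ary digit of `n`. -/
theorem ceil_single_sum_real (b j : ℕ) (hb : 2 ≤ b) (hj1 : 1 ≤ j) (hj2 : j ≤ b - 1)
    (x : ℝ) (hx : 1 ≤ x) (n : ℕ) (hn : (n : ℤ) = ⌈x⌉)
    (hlog : ⌊Real.logb b x⌋ = (Nat.log b n : ℤ)) :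
    ∑ k ∈ Finset.range (Nat.log b n + 1), ⌈(x + j * (b : ℝ) ^ k) / b ^ (k + 1)⌉ =
      (((n - digitSum b n) / (b - 1) + Nat.log b n + conjPart b n (b - j)
        + if n / b ^ (padicValNat b n) % b ≠ b - j then 1 else 0 : ℕ) : ℤ) := by
  have hn0 : n ≠ 0 := by
    have : 0 < ⌈x⌉ := Int.ceil_pos.2 (by linarith)
    omega
  have hsum := Finset.sum_congr rfl fun k (_ : k ∈ Finset.range (Nat.log b n + 1)) =>
    ceil_add_mul_pow_div b j k n hb hj1 hj2 x hn
  have hlow := sum_range_digit_eq_and_dvd b n (b - j) hb hn0 (by omega)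
  simp only [Finset.sum_add_distrib, Finset.sum_const, Finset.card_range] at hsum
  rw [← sum_range_div_pow_succ b n hb, conjPart_eq_sum b n (b - j) hb hn0]
  have hlow := congrArg (Nat.cast : ℕ → ℤ) hlow
  simp only [Nat.cast_sum, Nat.cast_ite, Nat.cast_one, Nat.cast_zero] at hlow
  rw [hlow] at hsum
  push_cast
  simp only [nsmul_eq_mul, Nat.cast_add, Nat.cast_one] at hsum
  split_ifs at hsum ⊢ <;> first | contradiction | linarith
end

section
/- Let b ≥ 2 be an integer, let j be an integer with 1 ≤ j ≤ b−1, and let n ≥ 1 be an integer with m = ⌊log_b n⌋. Then ∑_{k=0}^{m} ((n + j·b^k) / b^{k+1})) = (1/(b−1))·(s_b(n) − n/b^{m+1}) + (m+1)·(j/b − 1/2) − λ'_{b−j}(n) + (1/2)·[c_{ν_b(n)} = b−j], where ((x)) denotes the sawtooth function equal to {x} − 1/2 when x is not an integer and equal to 0 when x is an integer, and c_{ν_b(n)} = ⌊n / b^{ν_b(n)}⌋ mod b is the lowest nonzero b-ary digit of n. -/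
/-- The sawtooth function `((x))`: equal to `{x} − 1/2` when `x` is not an integer
(i.e., when `{x} ≠ 0`) and equal to `0` when `x` is an integer. -/
def sawtooth (x : ℚ) : ℚ := if Int.fract x = 0 then 0 else Int.fract x - 1 / 2

theorem Nat.digits_eq_map_range_log {b n : ℕ} (hb : 2 ≤ b) (hn : n ≠ 0) :
    Nat.digits b n = (List.range (Nat.log b n + 1)).map fun k => n / b ^ k % b := by
  refine List.ext_getElem (by simp [Nat.length_digits b n hb hn]) fun i h₁ h₂ => ?_
  rw [← List.getD_eq_getElem _ 0 h₁, Nat.getD_digits n i hb]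
  simp

theorem digitSum_eq_sum_range {b n : ℕ} (hb : 2 ≤ b) (hn : n ≠ 0) :
    digitSum b n = ∑ k ∈ Finset.range (Nat.log b n + 1), n / b ^ k % b := by
  rw [digitSum, Nat.digits_eq_map_range_log hb hn]
  rfl

theorem conjPart_eq_sum_range {b n : ℕ} (hb : 2 ≤ b) (hn : n ≠ 0) (i : ℕ) :
    conjPart b n i =
      ∑ k ∈ Finset.range (Nat.log b n + 1), if i ≤ n / b ^ k % b then 1 else 0 := by
  rw [conjPart, Nat.digits_eq_map_range_log hb hn, ← Finset.card_filter, List.filter_map,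
    List.length_map]
  rfl

/-- Summing the scaled remainders `(n mod b^(k+1)) / b^(k+1)` telescopes to a digit sum. -/
theorem sum_mod_pow_div_pow {b : ℕ} (hb : 2 ≤ b) (n M : ℕ) :
    ∑ k ∈ Finset.range M, ((n % b ^ (k + 1) : ℕ) : ℚ) / (b : ℚ) ^ (k + 1) =
      1 / ((b : ℚ) - 1) * (((∑ k ∈ Finset.range M, n / b ^ k % b : ℕ) : ℚ)
        - ((n % b ^ M : ℕ) : ℚ) / (b : ℚ) ^ M) := by
  have hb' : (2 : ℚ) ≤ b := by exact_mod_cast hb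
  have h₀ : (b : ℚ) ≠ 0 := by linarith
  have h₁ : (b : ℚ) - 1 ≠ 0 := by linarith
  induction M with
  | zero => simp [Nat.mod_one]
  | succ M ih =>
    rw [Finset.sum_range_succ, ih, Finset.sum_range_succ, Nat.mod_pow_succ]
    push_cast
    field_simp
    ring

/-- The sawtooth value at `(n + j b^k) / b^(k+1)` in terms of the `k`-th digit of `n`. -/
theorem sawtooth_add_mul_pow_div {b j : ℕ} (hj1 : 1 ≤ j) (hj2 : j ≤ b - 1) (n k : ℕ) :
    sawtooth (((n : ℚ) + j * b ^ k) / b ^ (k + 1)) =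
      ((n % b ^ (k + 1) : ℕ) : ℚ) / (b : ℚ) ^ (k + 1) + ((j : ℚ) / b - 1 / 2)
        - (if b - j ≤ n / b ^ k % b then 1 else 0)
        + 1 / 2 * (if b ^ k ∣ n ∧ n / b ^ k % b = b - j then 1 else 0) := by
  have hb0 : 0 < b := by omega
  have hB : 0 < b ^ k := Nat.pow_pos hb0
  have hdiv : n = b ^ (k + 1) * (n / b ^ (k + 1)) + n % b ^ (k + 1) := (Nat.div_add_mod _ _).symm
  have hr : n % b ^ k < b ^ k := Nat.mod_lt _ hB
  have hd : n / b ^ k % b < b := Nat.mod_lt _ hb0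
  simp only [Nat.dvd_iff_mod_eq_zero, Nat.mod_pow_succ]
  conv at hdiv => rhs; rw [Nat.mod_pow_succ]
  generalize n % b ^ k = r at *
  generalize n / b ^ k % b = d at *
  generalize n / b ^ (k + 1) = q at *
  rw [pow_succ] at hdiv ⊢
  have hBq : (b : ℚ) ^ k = (b ^ k : ℕ) := by push_cast; rfl
  rw [hBq]
  generalize b ^ k = B at *
  have hnq : (n : ℚ) = B * b * q + (r + B * d) := by exact_mod_cast hdiv
  have hbq : (0 : ℚ) < b := by exact_mod_cast hb0
  have hB' : (0 : ℚ) < B := by exact_mod_cast hB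
  have hr' : (r : ℚ) + 1 ≤ B := by exact_mod_cast hr
  have hr0 : (0 : ℚ) ≤ r := r.cast_nonneg
  have hj' : (1 : ℚ) ≤ j := by exact_mod_cast hj1
  have hBb : (0 : ℚ) < B * b := by positivity
  by_cases hc : d + j < b
  · have hc' : (d : ℚ) + j + 1 ≤ b := by exact_mod_cast hc
    have hf : Int.fract (((n : ℚ) + j * B) / (B * b)) = (r + B * (d + j)) / (B * b) := by
      rw [Int.fract_eq_iff]
      refine ⟨by positivity, ?_, q, ?_⟩
      · rw [div_lt_one hBb]
        nlinarith
      · rw [hnq]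
        push_cast
        field_simp
        ring
    have hne : ((r : ℚ) + B * (d + j)) / (B * b) ≠ 0 := by positivity
    rw [sawtooth, hf, if_neg hne, if_neg (by omega), if_neg (by omega)]
    push_cast
    field_simp
    ring
  · have hc' : (b : ℚ) ≤ d + j := by exact_mod_cast not_lt.mp hc
    have hdj : (d : ℚ) + j + 2 ≤ b + b := by
      have : d + j + 2 ≤ b + b := by omega
      exact_mod_cast this
    have hf : Int.fract (((n : ℚ) + j * B) / (B * b)) = (r + B * (d + j - b)) / (B * b) := by
      have : (0 : ℚ) ≤ d + j - b := by linarith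
      rw [Int.fract_eq_iff]
      refine ⟨by positivity, ?_, q + 1, ?_⟩
      · rw [div_lt_one hBb]
        nlinarith
      · rw [hnq]
        push_cast
        field_simp
        ring
    have hz : ((r : ℚ) + B * (d + j - b)) / (B * b) = 0 ↔ r = 0 ∧ d = b - j := by
      have h₁ : (0 : ℚ) ≤ B * (d + j - b) := mul_nonneg hB'.le (by linarith)
      rw [div_eq_zero_iff, or_iff_left hBb.ne', add_eq_zero_iff_of_nonneg hr0 h₁,
        mul_eq_zero, or_iff_right hB'.ne', Nat.cast_eq_zero, sub_eq_zero]
      have : (d : ℚ) + j = b ↔ d + j = b := by exact_mod_cast Iff.rfl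
      rw [this]
      omega
    rw [sawtooth, hf, if_pos (show b - j ≤ d by omega)]
    by_cases hs : r = 0 ∧ d = b - j
    · rw [if_pos (hz.mpr hs), if_pos hs]
      have hv := hz.mpr hs
      have : ((r : ℚ) + B * (d + j - b)) / (B * b) =
          ((r + B * d : ℕ) : ℚ) / (B * b) + j / b - 1 := by
        push_cast
        field_simp
        ring
      linarith
    · rw [if_neg (mt hz.mp hs), if_neg hs]
      push_cast
      field_simp
      ring

/-- Only the lowest nonzero digit can be a nonzero digit at a position `k` with `b^k ∣ n`. -/
theorem pow_dvd_and_digit_eq_iff {b n k i : ℕ} (hb : 2 ≤ b) (hn : n ≠ 0) (hi : i ≠ 0) :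
    (b ^ k ∣ n ∧ n / b ^ k % b = i) ↔
      k = padicValNat b n ∧ n / b ^ padicValNat b n % b = i := by
  have hdvd (l : ℕ) : b ^ l ∣ n ↔ l ≤ padicValNat b n :=
    padicValNat_dvd_iff_le_of_ne_one (by omega) hn
  constructor
  · rintro ⟨h₁, h₂⟩
    have hk : k = padicValNat b n := by
      refine le_antisymm ((hdvd k).mp h₁) (not_lt.mp fun hlt => hi ?_)
      rw [← h₂, ← Nat.dvd_iff_mod_eq_zero]
      exact (Nat.dvd_div_iff_mul_dvd h₁).mpr (by rw [← pow_succ]; exact (hdvd _).mpr hlt)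
    exact ⟨hk, hk ▸ h₂⟩
  · rintro ⟨rfl, h⟩
    exact ⟨(hdvd _).mpr le_rfl, h⟩

/-- For a base `b ≥ 2`, an integer `1 ≤ j ≤ b-1` and an integer `n ≥ 1` with
`m = ⌊log_b n⌋`, we have
`∑_{k=0}^{m} ((n + j·b^k)/b^(k+1)))
  = (1/(b−1))·(s_b(n) − n/b^(m+1)) + (m+1)·(j/b − 1/2) − λ'_{b−j}(n)
    + (1/2)·[c_{ν_b(n)} = b−j]`,
where `c_{ν_b(n)} = ⌊n/b^(ν_b(n))⌋ mod b` is the lowest nonzero `b`-ary digit of `n`. -/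
theorem sawtooth_single_sum (b j n : ℕ) (hb : 2 ≤ b) (hj1 : 1 ≤ j) (hj2 : j ≤ b - 1)
    (hn : 1 ≤ n) :
    ∑ k ∈ Finset.range (Nat.log b n + 1), sawtooth (((n : ℚ) + j * b ^ k) / b ^ (k + 1)) =
      (1 / ((b : ℚ) - 1)) * ((digitSum b n : ℚ) - (n : ℚ) / b ^ (Nat.log b n + 1))
        + ((Nat.log b n : ℚ) + 1) * ((j : ℚ) / b - 1 / 2) - conjPart b n (b - j)
        + (1 / 2) * (if n / b ^ (padicValNat b n) % b = b - j then 1 else 0) := by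
  have hn0 : n ≠ 0 := by omega
  have hlt : n < b ^ (Nat.log b n + 1) := Nat.lt_pow_succ_log_self (by omega) n
  have hcount : ∑ k ∈ Finset.range (Nat.log b n + 1),
      (if b ^ k ∣ n ∧ n / b ^ k % b = b - j then (1 : ℚ) else 0) =
        if n / b ^ padicValNat b n % b = b - j then 1 else 0 := by
    have hmem : padicValNat b n ∈ Finset.range (Nat.log b n + 1) :=
      Finset.mem_range.mpr (Nat.lt_succ_of_le (padicValNat_le_nat_log n))
    simp only [pow_dvd_and_digit_eq_iff hb hn0 (show b - j ≠ 0 by omega), ite_and]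
    rw [Finset.sum_ite_eq', if_pos hmem]
  simp only [sawtooth_add_mul_pow_div hj1 hj2]
  rw [Finset.sum_add_distrib, Finset.sum_sub_distrib, Finset.sum_add_distrib,
    sum_mod_pow_div_pow hb, ← Finset.mul_sum, hcount, Nat.mod_eq_of_lt hlt,
    ← digitSum_eq_sum_range hb hn0, conjPart_eq_sum_range hb hn0]
  simp
  ring
end
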